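/- Suppose P_U = ∅, all μ_{kℓ} equal a common constant μ ≥ 1 for (k,ℓ) ∈ E(P), and |λ_j| = λ_s > 0 for all j ∈ P_S. If the switching signal σ satisfies an average dwell time, i.e., there exist N_0 > 0 and τ_a > 0 with N(s,t) ≤ N_0 + (t−s)/τ_a for every 0 ≤ s < t, and τ_a > (ln μ)/λ_s, then the switched system ẋ(t) = f_{σ(t)}(x(t)) is globally asymptotically stable under σ. -/

import Mathlib

open Filter MeasureTheory Set

noncomputable section

/-- A switching signal: strictly increasing switching instants `tau 0 = 0 < tau 1 < ...`
tending to `+∞`, together with the signal `sig` itself, constant on `[tau i, tau (i+1))`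
and actually switching at each `tau (i+1)`. -/
structure SwitchSig (P : Type*) where
  tau : ℕ → ℝ
  sig : ℝ → P
  tau0 : tau 0 = 0
  mono : StrictMono tau
  tends : Filter.Tendsto tau Filter.atTop Filter.atTop
  const : ∀ i : ℕ, ∀ t : ℝ, tau i ≤ t → t < tau (i + 1) → sig t = sig (tau i)
  switch : ∀ i : ℕ, sig (tau i) ≠ sig (tau (i + 1))

namespace SwitchSig

variable {P : Type*} (S : SwitchSig P)

/-- `N s t` : the number of switching instants in `(s, t]`. -/
def N (s t : ℝ) : ℕ := Set.ncard {i : ℕ | s < S.tau i ∧ S.tau i ≤ t}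

/-- `Ntrans k l t` : the number of transitions from `k` to `l` occurring up to time `t`. -/
def Ntrans (k l : P) (t : ℝ) : ℕ :=
  Set.ncard {i : ℕ | S.tau (i + 1) ≤ t ∧ S.sig (S.tau i) = k ∧ S.sig (S.tau (i + 1)) = l}

/-- `Nmode j s t` : the number of switching instants in `(s, t]` at which subsystem `j`
is activated. -/
def Nmode (j : P) (s t : ℝ) : ℕ :=
  Set.ncard {i : ℕ | s < S.tau i ∧ S.tau i ≤ t ∧ S.sig (S.tau i) = j}

/-- `T j s t` : the total duration of activation of subsystem `j` on `(s, t]`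
(Lebesgue measure). -/
def T (j : P) (s t : ℝ) : ℝ :=
  (MeasureTheory.volume {r : ℝ | s < r ∧ r ≤ t ∧ S.sig r = j}).toReal

/-- switching frequency `ν(t) = N(0,t)/t`. -/
def nu (t : ℝ) : ℝ := (S.N 0 t : ℝ) / t

/-- transition frequency `ρ_{kl}(t) = N_{kl}(0,t)/N(0,t)`. -/
def rho (k l : P) (t : ℝ) : ℝ := (S.Ntrans k l t : ℝ) / (S.N 0 t : ℝ)

/-- fraction of activation `η_j(t) = T_j(0,t)/t`. -/
def eta (j : P) (t : ℝ) : ℝ := S.T j 0 t / t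

end SwitchSig

/-- A (Carathéodory-type) solution of the switched system `ẋ = f_{σ(t)}(x)`:
continuous on `[0, ∞)` and differentiable, with the prescribed derivative, in the
interior of every inter-switch interval. -/
def IsSolution {P : Type*} {E : Type*} [NormedAddCommGroup E] [NormedSpace ℝ E]
    (S : SwitchSig P) (f : P → E → E) (x : ℝ → E) : Prop :=
  ContinuousOn x (Set.Ici (0 : ℝ)) ∧
  ∀ i : ℕ, ∀ t : ℝ, S.tau i < t → t < S.tau (i + 1) →
    HasDerivAt x (f (S.sig t) (x t)) t

/-- Class `K∞` functions. -/
def ClassKInf (g : ℝ → ℝ) : Prop :=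
  ContinuousOn g (Set.Ici (0 : ℝ)) ∧ StrictMonoOn g (Set.Ici (0 : ℝ)) ∧ g 0 = 0 ∧
  Filter.Tendsto g Filter.atTop Filter.atTop

/-- Assumption 1: Lyapunov-like functions `V i`, sandwiched between class-`K∞`
functions of the norm, decaying at rate `lam i` (positive on `PS`, negative on `PU`)
along solutions of each subsystem. -/
def Assumption1 {P : Type*} {E : Type*} [NormedAddCommGroup E] [NormedSpace ℝ E]
    (f : P → E → E) (V : P → E → ℝ) (lam : P → ℝ) (PS PU : Finset P)
    (lo hi : ℝ → ℝ) : Prop :=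
  ClassKInf lo ∧ ClassKInf hi ∧
  (∀ i : P, ContDiff ℝ 1 (V i)) ∧
  (∀ i : P, ∀ ξ : E, 0 ≤ V i ξ) ∧
  (∀ j ∈ PS, 0 < lam j) ∧ (∀ k ∈ PU, lam k < 0) ∧
  (∀ i : P, ∀ ξ : E, lo ‖ξ‖ ≤ V i ξ ∧ V i ξ ≤ hi ‖ξ‖) ∧
  (∀ i : P, ∀ γ : ℝ → E, ContinuousOn γ (Set.Ici (0 : ℝ)) →
    (∀ t : ℝ, 0 < t → HasDerivAt γ (f i (γ t)) t) →
    ∀ t : ℝ, 0 ≤ t → V i (γ t) ≤ V i (γ 0) * Real.exp (-(lam i) * t))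

/-- Assumption 2: for every admissible transition `(i, j)` there is `μ_{ij} ≥ 1`
with `V j ≤ μ_{ij} • V i` pointwise. -/
def Assumption2 {P : Type*} {E : Type*}
    (V : P → E → ℝ) (mu : P → P → ℝ) (Eadm : Finset (P × P)) : Prop :=
  ∀ p ∈ Eadm, 1 ≤ mu p.1 p.2 ∧ ∀ ξ : E, V p.2 ξ ≤ mu p.1 p.2 * V p.1 ξ

/-- Global asymptotic stability of the switched system under the switching signal `S`:
Lyapunov stability together with global asymptotic convergence of every solution. -/
def IsGAS {P : Type*} {E : Type*} [NormedAddCommGroup E] [NormedSpace ℝ E]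
    (S : SwitchSig P) (f : P → E → E) : Prop :=
  (∀ ε : ℝ, 0 < ε → ∃ δ : ℝ, 0 < δ ∧ ∀ x : ℝ → E, IsSolution S f x → ‖x 0‖ < δ →
      ∀ t : ℝ, 0 ≤ t → ‖x t‖ < ε) ∧
  ∀ x : ℝ → E, IsSolution S f x → Filter.Tendsto x Filter.atTop (nhds (0 : E))

/-- `a` is continuous on `[0, T]` and is an integral curve of the vector field `g` on `(0, T)`. -/
def SolvesOn {E : Type*} [NormedAddCommGroup E] [NormedSpace ℝ E]
    (g : E → E) (a : ℝ → E) (T : ℝ) : Prop :=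
  ContinuousOn a (Icc 0 T) ∧ ∀ t ∈ Ioo 0 T, HasDerivAt a (g (a t)) t

section GlobalExistence

variable {E : Type*} [NormedAddCommGroup E] [NormedSpace ℝ E] {g : E → E} {K : NNReal}

/-- For a globally Lipschitz vector field, local solutions exist on an interval whose length does
not depend on the initial condition. -/
lemma LipschitzWith.exists_uniform_local_solution [CompleteSpace E] (hg : LipschitzWith K g) :
    ∃ h : ℝ, 0 < h ∧ ∀ (t₀ : ℝ) (x₀ : E), ∃ α : ℝ → E, α t₀ = x₀ ∧
      ∀ t ∈ Icc (t₀ - h) (t₀ + h), HasDerivWithinAt α (g (α t)) (Icc (t₀ - h) (t₀ + h)) t := by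
  have hh : (0 : ℝ) < 1 / (K + 1) := by positivity
  refine ⟨1 / (K + 1), hh, fun t₀ x₀ ↦ ?_⟩
  have hmem : t₀ ∈ Icc (t₀ - 1 / ((K : ℝ) + 1)) (t₀ + 1 / ((K : ℝ) + 1)) :=
    ⟨by linarith, by linarith⟩
  have hpl : IsPicardLindelof (fun _ ↦ g) (⟨t₀, hmem⟩ : Icc _ _) x₀ (‖g x₀‖₊ + 1) 0
      ((K + 1) * (‖g x₀‖₊ + 1)) K := by
    refine ⟨fun _ _ ↦ hg.lipschitzOnWith, fun _ _ ↦ continuousOn_const, fun _ _ x hx ↦ ?_, ?_⟩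
    · have h1 : ‖g x - g x₀‖ ≤ K * ‖x - x₀‖ := hg.norm_sub_le x x₀
      have h2 : ‖x - x₀‖ ≤ ‖g x₀‖ + 1 := by
        simpa [dist_eq_norm] using hx
      have h3 : ‖g x‖ ≤ ‖g x - g x₀‖ + ‖g x₀‖ := norm_le_norm_sub_add _ _
      have h4 : (K : ℝ) * ‖x - x₀‖ ≤ K * (‖g x₀‖ + 1) := by gcongr
      push_cast
      linarith
    · push_cast
      simp only [add_sub_cancel_left, sub_sub_cancel, max_self]
      apply le_of_eq
      field_simp
      ring
  exact hpl.exists_eq_forall_mem_Icc_hasDerivWithinAt₀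

lemma SolvesOn.hasDerivWithinAt_right_endpoint {a : ℝ → E} {T : ℝ} (hg : Continuous g)
    (ha : SolvesOn g a T) (hT : 0 < T) : HasDerivWithinAt a (g (a T)) (Iic T) T := by
  have hs : Ioo 0 T ∈ nhdsWithin T (Iio T) := Ioo_mem_nhdsLT hT
  have hc : ContinuousWithinAt a (Ioo 0 T) T :=
    (ha.1 T ⟨hT.le, le_rfl⟩).mono Ioo_subset_Icc_self
  refine hasDerivWithinAt_Iic_of_tendsto_deriv (s := Ioo 0 T)
    (fun t ht ↦ (ha.2 t ht).differentiableAt.differentiableWithinAt) hc hs ?_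
  have hlim : Tendsto (fun t ↦ g (a t)) (nhdsWithin T (Iio T)) (nhds (g (a T))) :=
    (hg.tendsto _).comp (hc.tendsto.mono_left (nhdsWithin_le_of_mem hs))
  refine hlim.congr' ?_
  filter_upwards [hs] with t ht using (ha.2 t ht).deriv.symm

/-- A solution on `[0, T]` followed by a solution through its endpoint is a solution. -/
lemma SolvesOn.concat {a α : ℝ → E} {T h : ℝ} (hg : Continuous g) (ha : SolvesOn g a T)
    (hT : 0 < T) (hh : 0 < h) (hα₀ : α T = a T)
    (hα : ∀ t ∈ Icc (T - h) (T + h), HasDerivWithinAt α (g (α t)) (Icc (T - h) (T + h)) t) :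
    SolvesOn g (fun t ↦ if t ≤ T then a t else α t) (T + h) := by
  set b : ℝ → E := fun t ↦ if t ≤ T then a t else α t with hb
  have hba : EqOn b a (Iic T) := fun t ht ↦ if_pos ht
  have hbα : EqOn b α (Ici T) := fun t ht ↦ by
    rcases eq_or_lt_of_le (show T ≤ t from ht) with rfl | h'
    · simp [hb, hα₀]
    · simp [hb, not_le.2 h']
  have hder : ∀ t ∈ Ioo (T - h) (T + h), HasDerivAt α (g (α t)) t := fun t ht ↦
    (hα t (Ioo_subset_Icc_self ht)).hasDerivAt (Icc_mem_nhds ht.1 ht.2)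
  refine ⟨?_, fun t ht ↦ ?_⟩
  · rw [← Icc_union_Icc_eq_Icc hT.le (by linarith : T ≤ T + h)]
    refine ContinuousOn.union_of_isClosed ?_ ?_ isClosed_Icc isClosed_Icc
    · exact ha.1.congr (hba.mono fun t ht ↦ ht.2)
    · have hαc : ContinuousOn α (Icc (T - h) (T + h)) := fun t ht ↦ (hα t ht).continuousWithinAt
      exact (hαc.mono (Icc_subset_Icc_left (by linarith))).congr (hbα.mono fun t ht ↦ ht.1)
  · rcases lt_trichotomy t T with hlt | rfl | hgt
    · rw [hba hlt.le]
      refine (ha.2 t ⟨ht.1, hlt⟩).congr_of_eventuallyEq ?_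
      filter_upwards [Iio_mem_nhds hlt] with s hs using hba (mem_Iic.2 (mem_Iio.1 hs).le)
    · have hl : HasDerivWithinAt b (g (b t)) (Iic t) t := by
        rw [hba self_mem_Iic]
        exact (ha.hasDerivWithinAt_right_endpoint hg hT).congr hba (hba self_mem_Iic)
      have hr : HasDerivWithinAt b (g (b t)) (Ici t) t := by
        rw [hbα self_mem_Ici]
        exact (hder t ⟨by linarith, by linarith⟩).hasDerivWithinAt.congr hbα (hbα self_mem_Ici)
      have hu := hl.union hr
      rwa [Iic_union_Ici, hasDerivWithinAt_univ] at hu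
    · rw [hbα hgt.le]
      refine (hder t ⟨by linarith, ht.2⟩).congr_of_eventuallyEq ?_
      filter_upwards [Ioi_mem_nhds hgt] with s hs using hbα (mem_Ici.2 (mem_Ioi.1 hs).le)

/-- Solutions of a globally Lipschitz autonomous equation extend to `[0, ∞)`. -/
lemma SolvesOn.exists_global_extension [CompleteSpace E] {a : ℝ → E} {T : ℝ}
    (hg : LipschitzWith K g) (ha : SolvesOn g a T) (hT : 0 < T) :
    ∃ γ : ℝ → E, EqOn γ a (Icc 0 T) ∧ ContinuousOn γ (Ici 0) ∧
      ∀ t : ℝ, 0 < t → HasDerivAt γ (g (γ t)) t := by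
  obtain ⟨h, hh, hloc⟩ := hg.exists_uniform_local_solution
  have hstep : ∀ (c : ℝ → E) (R : ℝ), 0 < R → SolvesOn g c R →
      ∃ b : ℝ → E, SolvesOn g b (R + h) ∧ EqOn b c (Icc 0 R) := by
    intro c R hR hc
    obtain ⟨α, hα₀, hα⟩ := hloc R (c R)
    exact ⟨_, hc.concat hg.continuous hR hh hα₀ hα, fun t ht ↦ if_pos ht.2⟩
  choose! F hF hFeq using hstep
  let b : ℕ → ℝ → E := fun n ↦ Nat.rec a (fun n c ↦ F c (T + n * h)) n
  have hpos : ∀ n : ℕ, 0 < T + n * h := fun n ↦ by positivity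
  have hb : ∀ n : ℕ, SolvesOn g (b n) (T + n * h) := by
    intro n
    induction n with
    | zero => simpa [b] using ha
    | succ n ih =>
      have := hF (b n) _ (hpos n) ih
      rwa [show T + n * h + h = T + ((n + 1 : ℕ) : ℝ) * h by push_cast; ring] at this
  have hmono : ∀ n m : ℕ, n ≤ m → EqOn (b m) (b n) (Icc 0 (T + n * h)) := by
    intro n m hnm
    induction m, hnm using Nat.le_induction with
    | base => exact fun _ _ ↦ rfl
    | succ m hnm ih =>
      intro t ht
      have hle : T + n * h ≤ T + m * h := by gcongr
      exact (hFeq (b m) _ (hpos m) (hb m) ⟨ht.1, ht.2.trans hle⟩).trans (ih ht)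
  let γ : ℝ → E := fun t ↦ b ⌈t / h⌉₊ t
  have hγ : ∀ n : ℕ, EqOn γ (b n) (Icc 0 (T + n * h)) := by
    intro n t ht
    rcases le_total n ⌈t / h⌉₊ with hn | hn
    · exact hmono _ _ hn ht
    · have h1 : t ≤ ⌈t / h⌉₊ * h := (div_le_iff₀ hh).1 (Nat.le_ceil _)
      exact (hmono _ _ hn ⟨ht.1, by linarith⟩).symm
  have hlt : ∀ t : ℝ, ∃ n : ℕ, t < T + n * h := by
    intro t
    refine ⟨⌈t / h⌉₊, ?_⟩
    have h1 : t ≤ ⌈t / h⌉₊ * h := (div_le_iff₀ hh).1 (Nat.le_ceil _)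
    linarith
  refine ⟨γ, by simpa [b] using hγ 0, fun t ht ↦ ?_, fun t ht ↦ ?_⟩
  · obtain ⟨n, hn⟩ := hlt t
    have ht' : t ∈ Icc 0 (T + n * h) := ⟨ht, hn.le⟩
    refine ((hb n).1.congr (hγ n) t ht').mono_of_mem_nhdsWithin ?_
    rw [← Ici_inter_Iic]
    exact inter_mem self_mem_nhdsWithin (mem_nhdsWithin_of_mem_nhds (Iic_mem_nhds hn))
  · obtain ⟨n, hn⟩ := hlt t
    rw [hγ n ⟨ht.le, hn.le⟩]
    refine ((hb n).2 t ⟨ht, hn⟩).congr_of_eventuallyEq ?_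
    filter_upwards [Ioo_mem_nhds ht hn] with s hs using hγ n (Ioo_subset_Icc_self hs)

/-- An exponential estimate valid along global solutions holds along solutions on `[0, T]`. -/
lemma SolvesOn.exp_estimate [CompleteSpace E] {a : ℝ → E} {T l : ℝ} {W : E → ℝ}
    (hg : LipschitzWith K g)
    (hW : ∀ γ : ℝ → E, ContinuousOn γ (Ici 0) → (∀ t : ℝ, 0 < t → HasDerivAt γ (g (γ t)) t) →
      ∀ t : ℝ, 0 ≤ t → W (γ t) ≤ W (γ 0) * Real.exp (-l * t))
    (ha : SolvesOn g a T) (hT : 0 < T) {t : ℝ} (ht : t ∈ Icc 0 T) :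
    W (a t) ≤ W (a 0) * Real.exp (-l * t) := by
  obtain ⟨γ, hγa, hγc, hγd⟩ := ha.exists_global_extension hg hT
  have := hW γ hγc hγd t ht.1
  rwa [hγa ht, hγa ⟨le_rfl, hT.le⟩] at this

end GlobalExistence

namespace SwitchSig

variable {P : Type*} (S : SwitchSig P)

lemma tau_nonneg (i : ℕ) : 0 ≤ S.tau i := S.tau0 ▸ S.mono.monotone (Nat.zero_le i)

lemma exists_mem_Ico {t : ℝ} (ht : 0 ≤ t) : ∃ i : ℕ, t ∈ Ico (S.tau i) (S.tau (i + 1)) := by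
  have hex : ∃ n : ℕ, t < S.tau n := (S.tends.eventually_gt_atTop t).exists
  obtain ⟨i, hi⟩ : ∃ i, Nat.find hex = i + 1 := Nat.exists_eq_succ_of_ne_zero fun h0 ↦ by
    have := Nat.find_spec hex
    rw [h0, S.tau0] at this
    linarith
  exact ⟨i, not_lt.1 (Nat.find_min hex (by lia)), hi ▸ Nat.find_spec hex⟩

lemma N_zero_eq {i : ℕ} {t : ℝ} (ht : t ∈ Ico (S.tau i) (S.tau (i + 1))) : S.N 0 t = i := by
  have : {k : ℕ | 0 < S.tau k ∧ S.tau k ≤ t} = (Finset.Icc 1 i : Finset ℕ) := by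
    ext k
    simp only [mem_ofPred_eq, Finset.coe_Icc, mem_Icc]
    constructor
    · rintro ⟨h1, h2⟩
      rw [← S.tau0] at h1
      have h3 := S.mono.lt_iff_lt.1 h1
      have h4 := S.mono.lt_iff_lt.1 (h2.trans_lt ht.2)
      lia
    · rintro ⟨h1, h2⟩
      exact ⟨S.tau0 ▸ S.mono (by lia), (S.mono.monotone h2).trans ht.1⟩
  rw [N, this, Set.ncard_coe_finset, Nat.card_Icc, Nat.add_sub_cancel]

end SwitchSig

section Switched

variable {P E : Type*} [NormedAddCommGroup E] [NormedSpace ℝ E] {S : SwitchSig P}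
  {f : P → E → E} {x : ℝ → E}

lemma IsSolution.solvesOn_shift (hx : IsSolution S f x) (i : ℕ) :
    SolvesOn (f (S.sig (S.tau i))) (fun s ↦ x (S.tau i + s)) (S.tau (i + 1) - S.tau i) := by
  refine ⟨?_, fun t ht ↦ ?_⟩
  · refine hx.1.comp (by fun_prop) fun s hs ↦ ?_
    exact add_nonneg (S.tau_nonneg i) hs.1
  · have h1 : S.tau i < S.tau i + t := by linarith [ht.1]
    have h2 : S.tau i + t < S.tau (i + 1) := by linarith [ht.2]
    have h3 := hx.2 i (S.tau i + t) h1 h2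
    rw [S.const i _ h1.le h2] at h3
    exact h3.comp_const_add (S.tau i) t

/-- Decay of the active Lyapunov function: exponential in time, up to one factor `m` for each
switch. -/
lemma IsSolution.lyapunov_le [CompleteSpace E] (hx : IsSolution S f x)
    (hLip : ∀ i : P, ∃ K : NNReal, LipschitzWith K (f i)) {V : P → E → ℝ} {l m : ℝ} (hm : 0 ≤ m)
    (hV : ∀ i : P, ∀ γ : ℝ → E, ContinuousOn γ (Ici 0) →
      (∀ t : ℝ, 0 < t → HasDerivAt γ (f i (γ t)) t) →
      ∀ t : ℝ, 0 ≤ t → V i (γ t) ≤ V i (γ 0) * Real.exp (-l * t))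
    (hjump : ∀ (i : ℕ) (ξ : E), V (S.sig (S.tau (i + 1))) ξ ≤ m * V (S.sig (S.tau i)) ξ)
    (i : ℕ) {t : ℝ} (ht : t ∈ Icc (S.tau i) (S.tau (i + 1))) :
    V (S.sig (S.tau i)) (x t) ≤ m ^ i * Real.exp (-l * t) * V (S.sig 0) (x 0) := by
  have hflow : ∀ i : ℕ, ∀ t ∈ Icc (S.tau i) (S.tau (i + 1)), V (S.sig (S.tau i)) (x t) ≤
      V (S.sig (S.tau i)) (x (S.tau i)) * Real.exp (-l * (t - S.tau i)) := by
    intro i t ht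
    obtain ⟨K, hK⟩ := hLip (S.sig (S.tau i))
    have := (hx.solvesOn_shift i).exp_estimate hK (hV _)
      (sub_pos.2 (S.mono i.lt_succ_self)) (t := t - S.tau i)
      ⟨sub_nonneg.2 ht.1, sub_le_sub_right ht.2 _⟩
    simpa using this
  have hcomb : ∀ i : ℕ, ∀ t : ℝ,
      V (S.sig (S.tau i)) (x (S.tau i)) ≤
        m ^ i * Real.exp (-l * S.tau i) * V (S.sig 0) (x 0) →
      V (S.sig (S.tau i)) (x (S.tau i)) * Real.exp (-l * (t - S.tau i)) ≤
        m ^ i * Real.exp (-l * t) * V (S.sig 0) (x 0) := by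
    intro i t h
    calc _ ≤ m ^ i * Real.exp (-l * S.tau i) * V (S.sig 0) (x 0) *
          Real.exp (-l * (t - S.tau i)) := by gcongr
      _ = m ^ i * (Real.exp (-l * S.tau i) * Real.exp (-l * (t - S.tau i))) *
          V (S.sig 0) (x 0) := by ring
      _ = _ := by rw [← Real.exp_add]; ring_nf
  have hswitch : ∀ i : ℕ, V (S.sig (S.tau i)) (x (S.tau i)) ≤
      m ^ i * Real.exp (-l * S.tau i) * V (S.sig 0) (x 0) := by
    intro i
    induction i with
    | zero => simp [S.tau0]
    | succ i ih =>
      have h1 := (hflow i _ ⟨S.mono.monotone i.le_succ, le_rfl⟩).trans (hcomb i _ ih)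
      calc _ ≤ m * V (S.sig (S.tau i)) (x (S.tau (i + 1))) := hjump i _
        _ ≤ m * (m ^ i * Real.exp (-l * S.tau (i + 1)) * V (S.sig 0) (x 0)) := by gcongr
        _ = _ := by rw [pow_succ]; ring
  exact (hflow i t ht).trans (hcomb i t (hswitch i))

/-- A uniform exponential bound in the class-`K∞` gauges implies global asymptotic stability. -/
lemma isGAS_of_exp_bound {lo hi : ℝ → ℝ} (hlo : ClassKInf lo) (hhi : ClassKInf hi) {C c : ℝ}
    (hC : 0 < C) (hc : 0 < c)
    (hbound : ∀ x : ℝ → E, IsSolution S f x → ∀ t : ℝ, 0 ≤ t →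
      lo ‖x t‖ ≤ C * Real.exp (-c * t) * hi ‖x 0‖) : IsGAS S f := by
  have hlopos : ∀ ε : ℝ, 0 < ε → 0 < lo ε := fun ε hε ↦ by
    simpa [hlo.2.2.1] using hlo.2.1 self_mem_Ici hε.le hε
  have hlt : ∀ (ξ : E) (ε : ℝ), 0 < ε → lo ‖ξ‖ < lo ε → ‖ξ‖ < ε := fun ξ ε hε h ↦
    (hlo.2.1.lt_iff_lt (norm_nonneg ξ) hε.le).1 h
  refine ⟨fun ε hε ↦ ?_, fun x hx ↦ ?_⟩
  · have hcont := hhi.1 0 self_mem_Ici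
    have hev : ∀ᶠ r in nhdsWithin (0 : ℝ) (Ici 0), hi r < lo ε / C := by
      refine hcont.tendsto.eventually_lt_const ?_
      rw [hhi.2.2.1]
      exact div_pos (hlopos ε hε) hC
    obtain ⟨δ, hδ, hball⟩ := Metric.mem_nhdsWithin_iff.1 hev
    refine ⟨δ, hδ, fun x hx hx0 t ht ↦ hlt _ _ hε ?_⟩
    have h1 : hi ‖x 0‖ < lo ε / C := hball ⟨by simpa using hx0, norm_nonneg (x 0)⟩
    have h2 : 0 ≤ hi ‖x 0‖ := by
      simpa [hhi.2.2.1] using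
        hhi.2.1.monotoneOn self_mem_Ici (norm_nonneg (x 0)) (norm_nonneg (x 0))
    have h3 : Real.exp (-c * t) ≤ 1 := Real.exp_le_one_iff.2 (by nlinarith)
    calc lo ‖x t‖ ≤ C * Real.exp (-c * t) * hi ‖x 0‖ := hbound x hx t ht
      _ ≤ C * 1 * hi ‖x 0‖ := by gcongr
      _ < lo ε := by rwa [mul_one, mul_comm, ← lt_div_iff₀ hC]
  · have hexp : Tendsto (fun t : ℝ ↦ C * Real.exp (-c * t) * hi ‖x 0‖) atTop (nhds 0) := by
      have h1 : Tendsto (fun t : ℝ ↦ -c * t) atTop atBot :=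
        tendsto_id.const_mul_atTop_of_neg (neg_neg_of_pos hc)
      simpa using ((Real.tendsto_exp_atBot.comp h1).const_mul C).mul_const (hi ‖x 0‖)
    rw [Metric.tendsto_nhds]
    intro ε hε
    filter_upwards [hexp.eventually_lt_const (hlopos ε hε), eventually_ge_atTop 0] with t h1 h2
    rw [dist_zero_right]
    exact hlt _ _ hε ((hbound x hx t h2).trans_lt h1)

end Switched

/-- The growth caused by the switches is dominated under an average dwell-time bound. -/
lemma pow_mul_exp_le_of_le_add_div {m l N₀ τ t : ℝ} {n : ℕ} (hm : 1 ≤ m)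
    (hn : (n : ℝ) ≤ N₀ + t / τ) :
    m ^ n * Real.exp (-l * t) ≤
      Real.exp (N₀ * Real.log m) * Real.exp (-(l - Real.log m / τ) * t) := by
  have hlog : 0 ≤ Real.log m := Real.log_nonneg hm
  have hpow : m ^ n = Real.exp (n * Real.log m) := by
    rw [Real.exp_nat_mul, Real.exp_log (by linarith)]
  rw [hpow, ← Real.exp_add, ← Real.exp_add, Real.exp_le_exp]
  calc n * Real.log m + -l * t ≤ (N₀ + t / τ) * Real.log m + -l * t := by gcongr
    _ = _ := by ring

theorem stmt1 {d : ℕ} {P : Type*} [Fintype P]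
    (S : SwitchSig P)
    (f : P → EuclideanSpace ℝ (Fin d) → EuclideanSpace ℝ (Fin d))
    (Eadm : Finset (P × P))
    (V : P → EuclideanSpace ℝ (Fin d) → ℝ) (lam : P → ℝ) (mu : P → P → ℝ)
    (lo hi : ℝ → ℝ)
    (hLip : ∀ i : P, ∃ K : NNReal, LipschitzWith K (f i))
    (hzero : ∀ i : P, f i 0 = 0)
    (hadm : ∀ i : ℕ, (S.sig (S.tau i), S.sig (S.tau (i + 1))) ∈ Eadm)
    -- `P_U = ∅` : all subsystems are stable
    (h1 : Assumption1 f V lam Finset.univ ∅ lo hi)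
    (h2 : Assumption2 V mu Eadm)
    (muc lams : ℝ)
    (hmuc : 1 ≤ muc) (hmuconst : ∀ p ∈ Eadm, mu p.1 p.2 = muc)
    (hlams : 0 < lams) (hlamconst : ∀ j : P, |lam j| = lams)
    (N0 taua : ℝ) (hN0 : 0 < N0) (htaua : 0 < taua)
    (hADT : ∀ s t : ℝ, 0 ≤ s → s < t → (S.N s t : ℝ) ≤ N0 + (t - s) / taua)
    (htbig : Real.log muc / lams < taua) :
    IsGAS S f := by
  obtain ⟨hlo, hhi, -, hVnn, hlam, -, hsand, hdec⟩ := h1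
  have hlameq : ∀ j : P, lam j = lams := fun j ↦ by
    rw [← hlamconst j, abs_of_pos (hlam j (Finset.mem_univ j))]
  have hrate : 0 < lams - Real.log muc / taua := by
    rw [sub_pos, div_lt_iff₀ htaua, mul_comm]
    exact (div_lt_iff₀ hlams).1 htbig
  refine isGAS_of_exp_bound hlo hhi (Real.exp_pos (N0 * Real.log muc)) hrate fun x hx t ht ↦ ?_
  obtain ⟨i, hi_mem⟩ := S.exists_mem_Ico ht
  have hcount : (i : ℝ) ≤ N0 + t / taua := by
    rcases ht.eq_or_lt with rfl | htpos
    · have hi0 : i = 0 := by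
        by_contra hne
        have := S.mono (Nat.pos_of_ne_zero hne)
        rw [S.tau0] at this
        exact absurd hi_mem.1 (not_le.2 this)
      simp [hi0, hN0.le]
    · simpa [S.N_zero_eq hi_mem] using hADT 0 t le_rfl htpos
  have hjump : ∀ (k : ℕ) (ξ : EuclideanSpace ℝ (Fin d)),
      V (S.sig (S.tau (k + 1))) ξ ≤ muc * V (S.sig (S.tau k)) ξ := fun k ξ ↦ by
    have := (h2 _ (hadm k)).2 ξ
    rwa [hmuconst _ (hadm k)] at this
  have hV := hx.lyapunov_le hLip (by linarith : 0 ≤ muc)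
    (fun j γ hγ hγ' s hs ↦ hlameq j ▸ hdec j γ hγ hγ' s hs) hjump i (Ico_subset_Icc_self hi_mem)
  calc lo ‖x t‖ ≤ V (S.sig (S.tau i)) (x t) := (hsand _ _).1
    _ ≤ muc ^ i * Real.exp (-lams * t) * V (S.sig 0) (x 0) := hV
    _ ≤ _ := mul_le_mul (pow_mul_exp_le_of_le_add_div hmuc hcount) (hsand _ _).2 (hVnn _ _)
      (by positivity)
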